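/- arXiv:math/9511225 — 2 statements merged into one kernel-verified Lean document; each statement's English description precedes it below -/
import Mathlib

section
/- Let K be a body in E^d. Then there exist a constant C > 0 and a positive integer n₀ such that for every integer n ≥ n₀, every n-reduced covering of E^d with replicas of K has upper density at most ϑ(K) + C·n^{−1/d}. In other words, Θ_n(K) ≤ ϑ(K) + O(n^{−1/d}). -/
open Set MeasureTheory

noncomputable section

/-- `d`-dimensional Euclidean space. -/
abbrev Euc (d : ℕ) := EuclideanSpace ℝ (Fin d)

/-- `L` is a replica of `K`: the image of `K` under an isometry of `Euc d`. -/
def IsReplica {d : ℕ} (K L : Set (Euc d)) : Prop :=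
  ∃ f : Euc d ≃ᵢ Euc d, f '' K = L

/-- A body: a nonempty compact connected set equal to the closure of its interior. -/
def IsBody {d : ℕ} (K : Set (Euc d)) : Prop :=
  K.Nonempty ∧ IsCompact K ∧ IsConnected K ∧ K = closure (interior K)

/-- A covering of `Euc d` with replicas of `K`. -/
def IsCovering {d : ℕ} (K : Set (Euc d)) (C : Set (Set (Euc d))) : Prop :=
  (∀ L ∈ C, IsReplica K L) ∧ ⋃₀ C = univ

/-- `n`-reduced covering. -/
def IsNReduced {d : ℕ} (K : Set (Euc d)) (C : Set (Set (Euc d))) (n : ℕ) : Prop :=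
  ¬ ∃ (S : Set (Set (Euc d))) (L : Fin (n - 1) → Set (Euc d)),
      S ⊆ C ∧ S.Finite ∧ S.ncard = n ∧
      (∀ j, IsReplica K (L j)) ∧
      (⋃₀ (C \ S)) ∪ (⋃ j, L j) = univ

/-- The lower density of a family of sets. -/
def lowerDensity {d : ℕ} (A : Set (Set (Euc d))) : ENNReal :=
  Filter.liminf (fun r : ℝ =>
      (∑' L : A, volume ((L : Set (Euc d)) ∩ Metric.ball 0 r)) /
        volume (Metric.ball (0 : Euc d) r)) Filter.atTop

/-- The upper density of a family of sets. -/
def upperDensity {d : ℕ} (A : Set (Set (Euc d))) : ENNReal :=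
  Filter.limsup (fun r : ℝ =>
      (∑' L : A, volume ((L : Set (Euc d)) ∩ Metric.ball 0 r)) /
        volume (Metric.ball (0 : Euc d) r)) Filter.atTop

/-- The covering density `ϑ(K)`: the infimum of the (lower) densities of all coverings
of `Euc d` with replicas of `K`. -/
def coveringDensity {d : ℕ} (K : Set (Euc d)) : ENNReal :=
  ⨅ (C : Set (Set (Euc d))) (_ : IsCovering K C), lowerDensity C

open Filter Topology

section Replica

variable {d : ℕ} {K L : Set (Euc d)}

lemma IsReplica.image (h : IsReplica K L) (g : Euc d ≃ᵢ Euc d) : IsReplica K (g '' L) := by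
  obtain ⟨f, rfl⟩ := h
  exact ⟨f.trans g, by rw [← image_comp]; rfl⟩

lemma isReplica_self (K : Set (Euc d)) : IsReplica K K :=
  ⟨IsometryEquiv.refl _, image_id K⟩

lemma IsReplica.volume_eq (h : IsReplica K L) : volume L = volume K := by
  obtain ⟨f, rfl⟩ := h
  have hf : f '' K = (· + f 0) '' (f.toRealLinearIsometryEquiv '' K) := by
    rw [← image_comp]
    refine image_congr fun x _ => ?_
    simp [IsometryEquiv.toRealLinearIsometryEquiv_apply]
  rw [hf, image_add_right, measure_preimage_add_right,
    LinearIsometryEquiv.image_eq_preimage_symm]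
  exact f.toRealLinearIsometryEquiv.symm.measurePreserving.measure_preimage_emb
    f.toRealLinearIsometryEquiv.symm.toHomeomorph.measurableEmbedding K

lemma IsReplica.nonempty (h : IsReplica K L) (hK : K.Nonempty) : L.Nonempty := by
  obtain ⟨f, rfl⟩ := h
  exact hK.image f

lemma IsReplica.dist_le_diam (h : IsReplica K L) (hK : Bornology.IsBounded K) {x y : Euc d}
    (hx : x ∈ L) (hy : y ∈ L) : dist x y ≤ Metric.diam K := by
  obtain ⟨f, rfl⟩ := h
  obtain ⟨a, ha, rfl⟩ := hx
  obtain ⟨b, hb, rfl⟩ := hy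
  rw [f.isometry.dist_eq]
  exact Metric.dist_le_diam_of_mem hK ha hb

end Replica

lemma IsBody.volume_pos {d : ℕ} {K : Set (Euc d)} (hK : IsBody K) : 0 < volume K := by
  have h : (interior K).Nonempty := by
    have := hK.1
    rwa [hK.2.2.2, closure_nonempty_iff] at this
  exact (isOpen_interior.measure_pos volume h).trans_le (measure_mono interior_subset)

section BallCounting

variable {d : ℕ} {ι : Type*}

lemma lintegral_card_filter_mem_ball (F : Finset ι) (p : ι → Euc d) (ρ : ℝ)
    [∀ x : Euc d, DecidablePred fun i => x ∈ Metric.ball (p i) ρ] :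
    ∫⁻ x, ((F.filter fun i => x ∈ Metric.ball (p i) ρ).card : ENNReal) =
      F.card * volume (Metric.ball (0 : Euc d) ρ) := by
  classical
  have h : ∀ x : Euc d, ((F.filter fun i => x ∈ Metric.ball (p i) ρ).card : ENNReal) =
      ∑ i ∈ F, (Metric.ball (p i) ρ).indicator (fun _ => 1) x := by
    intro x
    simp [Set.indicator_apply]
  simp_rw [h]
  rw [lintegral_finsetSum _ fun i _ => measurable_const.indicator Metric.isOpen_ball.measurableSet]
  simp [lintegral_indicator, Metric.isOpen_ball.measurableSet, Measure.addHaar_ball_center]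

open Classical in
/-- If balls of radius `ρ` inside `A` cover each point at most `n` times, then their total
volume is at most `n` times that of `A`. -/
lemma card_mul_volume_ball_le (F : Finset ι) (p : ι → Euc d) (ρ : ℝ) {A : Set (Euc d)}
    (hA : MeasurableSet A) (n : ℕ) (hsub : ∀ i ∈ F, Metric.ball (p i) ρ ⊆ A)
    (hn : ∀ x, (F.filter fun i => x ∈ Metric.ball (p i) ρ).card ≤ n) :
    F.card * volume (Metric.ball (0 : Euc d) ρ) ≤ n * volume A := by
  rw [← lintegral_card_filter_mem_ball F p ρ, ← lintegral_indicator_const hA]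
  refine lintegral_mono fun x => ?_
  by_cases hx : x ∈ A
  · simpa [hx] using hn x
  · rw [Finset.filter_false_of_mem fun i hi h => hx (hsub i hi h)]
    simp

open Classical in
/-- If balls of radius `ρ` cover each point of `A` at least `n` times, then their total volume
is at least `n` times that of `A`. -/
lemma mul_volume_le_card_mul_volume_ball (F : Finset ι) (p : ι → Euc d) (ρ : ℝ) {A : Set (Euc d)}
    (hA : MeasurableSet A) (n : ℕ)
    (hn : ∀ x ∈ A, n ≤ (F.filter fun i => x ∈ Metric.ball (p i) ρ).card) :
    n * volume A ≤ F.card * volume (Metric.ball (0 : Euc d) ρ) := by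
  rw [← lintegral_card_filter_mem_ball F p ρ, ← lintegral_indicator_const hA]
  refine lintegral_mono fun x => ?_
  by_cases hx : x ∈ A
  · simpa [hx] using hn x hx
  · simp [hx]

end BallCounting

lemma volume_ball_eq {d : ℕ} (hd : 0 < d) {r : ℝ} (hr : 0 ≤ r) :
    volume (Metric.ball (0 : Euc d) r) =
      ENNReal.ofReal (r ^ d) * volume (Metric.ball (0 : Euc d) 1) := by
  have : Nonempty (Fin d) := ⟨⟨0, hd⟩⟩
  rw [Measure.addHaar_ball _ _ hr]
  simp

lemma tendsto_volume_ball_add_div {d : ℕ} (hd : 0 < d) (a : ℝ) :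
    Tendsto (fun r : ℝ => volume (Metric.ball (0 : Euc d) (r + a)) /
      volume (Metric.ball (0 : Euc d) r)) atTop (𝓝 1) := by
  have h1 : Tendsto (fun r : ℝ => ENNReal.ofReal ((1 + a * r⁻¹) ^ d)) atTop (𝓝 1) := by
    have : Tendsto (fun r : ℝ => (1 + a * r⁻¹) ^ d) atTop (𝓝 ((1 + a * 0) ^ d)) :=
      ((tendsto_inv_atTop_zero.const_mul a).const_add 1).pow d
    simpa using ENNReal.tendsto_ofReal this
  refine h1.congr' ?_
  filter_upwards [eventually_gt_atTop 0, eventually_gt_atTop (-a)] with r hr hra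
  have hω : volume (Metric.ball (0 : Euc d) 1) ≠ 0 :=
    (Metric.measure_ball_pos volume _ one_pos).ne'
  rw [volume_ball_eq hd hr.le, volume_ball_eq hd (by linarith : 0 ≤ r + a),
    ENNReal.mul_div_mul_right _ _ hω measure_ball_lt_top.ne,
    ← ENNReal.ofReal_div_of_pos (by positivity), ← div_pow]
  congr 2
  field_simp

section Density

variable {d : ℕ} {K : Set (Euc d)} {C : Set (Set (Euc d))} {n : ℕ} {D R : ℝ}

/-- If every ball of radius `R` contains at most `n` members of a family of replicas, then
its upper density is correspondingly bounded. -/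
lemma upperDensity_le_of_encard_le (hd : 0 < d) (hK : IsCompact K) (hne : K.Nonempty)
    (hC : ∀ L ∈ C, IsReplica K L) (hD : Metric.diam K < D) (hR : D < R)
    (hn : ∀ x, {L ∈ C | L ⊆ Metric.ball x R}.encard ≤ n) :
    upperDensity C ≤ n * volume K / volume (Metric.ball (0 : Euc d) (R - D)) := by
  classical
  have hρ : 0 < R - D := sub_pos.2 hR
  have hβ0 : volume (Metric.ball (0 : Euc d) (R - D)) ≠ 0 :=
    (Metric.measure_ball_pos volume _ hρ).ne'
  have hβt : volume (Metric.ball (0 : Euc d) (R - D)) ≠ ⊤ := measure_ball_lt_top.ne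
  have hc : (n * volume K / volume (Metric.ball (0 : Euc d) (R - D))) ≠ ⊤ :=
    ENNReal.div_ne_top (ENNReal.mul_ne_top (by simp) hK.measure_lt_top.ne) hβ0
  have hlim := ENNReal.Tendsto.const_mul (tendsto_volume_ball_add_div hd R) (Or.inr hc)
  rw [mul_one] at hlim
  rw [← hlim.limsup_eq]
  refine limsup_le_limsup (Eventually.of_forall fun r => ?_)
  simp only [← mul_div_assoc]
  refine ENNReal.div_le_div_right (tsum_le_of_sum_le' zero_le fun F => ?_) _
  set G := F.filter fun L : C => ((L : Set (Euc d)) ∩ Metric.ball 0 r).Nonempty with hG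
  have hsum : ∑ L ∈ F, volume ((L : Set (Euc d)) ∩ Metric.ball 0 r) ≤ G.card * volume K := by
    rw [← nsmul_eq_mul, ← Finset.sum_const, hG, Finset.sum_filter]
    refine Finset.sum_le_sum fun L _ => ?_
    split_ifs with h
    · exact (measure_mono inter_subset_left).trans_eq (hC L L.2).volume_eq
    · simp [Set.not_nonempty_iff_eq_empty.1 h]
  refine hsum.trans ?_
  have hp : ∀ L : C, ∃ p ∈ (L : Set (Euc d)),
      ((L : Set (Euc d)) ∩ Metric.ball 0 r).Nonempty → p ∈ Metric.ball (0 : Euc d) r := by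
    intro L
    by_cases h : ((L : Set (Euc d)) ∩ Metric.ball 0 r).Nonempty
    · obtain ⟨p, hp⟩ := h
      exact ⟨p, hp.1, fun _ => hp.2⟩
    · obtain ⟨p, hp⟩ := (hC L L.2).nonempty hne
      exact ⟨p, hp, fun h' => absurd h' h⟩
  choose p hpL hpr using hp
  have key := card_mul_volume_ball_le G p (R - D)
    (A := Metric.ball 0 (r + R)) Metric.isOpen_ball.measurableSet n ?_ ?_
  · rw [← ENNReal.mul_div_right_comm, ENNReal.le_div_iff_mul_le (Or.inl hβ0) (Or.inl hβt)]
    calc _ = (G.card * volume (Metric.ball (0 : Euc d) (R - D))) * volume K := by ring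
      _ ≤ (n * volume (Metric.ball (0 : Euc d) (r + R))) * volume K := by gcongr
      _ = _ := by ring
  · intro L hL
    have h := hpr L (Finset.mem_filter.1 hL).2
    refine Metric.ball_subset_ball' ?_
    rw [Metric.mem_ball] at h
    have : 0 ≤ D := Metric.diam_nonneg.trans hD.le
    linarith
  · intro x
    have := (Set.encard_le_encard (s := Subtype.val ''
        ((G.filter fun L => x ∈ Metric.ball (p L) (R - D) : Finset C) : Set C))
      (t := {L ∈ C | L ⊆ Metric.ball x R}) ?_).trans (hn x)
    · rw [Subtype.val_injective.encard_image, Set.encard_coe_eq_coe_finsetCard] at this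
      exact_mod_cast this
    · rintro _ ⟨L, hL, rfl⟩
      refine ⟨L.2, fun y hy => ?_⟩
      have hx := (Finset.mem_filter.1 (Finset.mem_coe.1 hL)).2
      have := (hC L L.2).dist_le_diam hK.isBounded hy (hpL L)
      rw [Metric.mem_ball] at hx ⊢
      linarith [dist_triangle y (p L) x, dist_comm x (p L)]

/-- If every ball of radius `R` meets at least `n` members of a family of replicas, then its
lower density is correspondingly large. -/
lemma le_lowerDensity_of_le_encard (hd : 0 < d) (hK : IsBody K)
    (hC : ∀ L ∈ C, IsReplica K L) (hD : Metric.diam K < D) (hR : 0 < R)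
    (hn : ∀ x, n ≤ {L ∈ C | (L ∩ Metric.ball x R).Nonempty}.encard) :
    n * volume K / volume (Metric.ball (0 : Euc d) (R + D)) ≤ lowerDensity C := by
  classical
  have hD0 : 0 < D := Metric.diam_nonneg.trans_lt hD
  have hβ0 : volume (Metric.ball (0 : Euc d) (R + D)) ≠ 0 :=
    (Metric.measure_ball_pos volume _ (by linarith)).ne'
  have hβt : volume (Metric.ball (0 : Euc d) (R + D)) ≠ ⊤ := measure_ball_lt_top.ne
  have hvt : volume K ≠ ⊤ := hK.2.1.measure_lt_top.ne
  have hv0 : volume K ≠ 0 := hK.volume_pos.ne'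
  have hc : (n * volume K / volume (Metric.ball (0 : Euc d) (R + D))) ≠ ⊤ :=
    ENNReal.div_ne_top (ENNReal.mul_ne_top (by simp) hvt) hβ0
  have hlim := ENNReal.Tendsto.const_mul (tendsto_volume_ball_add_div hd (-(R + D))) (Or.inr hc)
  rw [mul_one] at hlim
  rw [← hlim.liminf_eq]
  refine liminf_le_liminf (Eventually.of_forall fun r => ?_)
  simp only [← mul_div_assoc]
  refine ENNReal.div_le_div_right ?_ _
  set T := ∑' L : C, volume ((L : Set (Euc d)) ∩ Metric.ball 0 r) with hT
  by_cases hTt : T = ⊤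
  · simp [hTt]
  have hfin : {L : C | volume K ≤ volume ((L : Set (Euc d)) ∩ Metric.ball 0 r)}.Finite :=
    ENNReal.finite_const_le_of_tsum_ne_top hTt hv0
  set F := hfin.toFinset with hF
  have hsum : F.card * volume K ≤ T := by
    refine le_trans ?_ (ENNReal.sum_le_tsum F)
    rw [← nsmul_eq_mul]
    refine Finset.card_nsmul_le_sum _ _ _ fun L hL => ?_
    simpa [hF] using hL
  have hp : ∀ L : C, ∃ p, p ∈ (L : Set (Euc d)) := fun L => (hC L L.2).nonempty hK.1
  choose p hpL using hp
  have key := mul_volume_le_card_mul_volume_ball F p (R + D)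
    (A := Metric.ball 0 (r + -(R + D))) Metric.isOpen_ball.measurableSet n ?_
  · rw [← ENNReal.mul_div_right_comm, ENNReal.div_le_iff hβ0 hβt]
    calc _ = (n * volume (Metric.ball (0 : Euc d) (r + -(R + D)))) * volume K := by ring
      _ ≤ (F.card * volume (Metric.ball (0 : Euc d) (R + D))) * volume K := by gcongr
      _ = (F.card * volume K) * volume (Metric.ball (0 : Euc d) (R + D)) := by ring
      _ ≤ _ := by gcongr
  · intro x hx
    have := (hn x).trans (Set.encard_le_encard (t := Subtype.val ''
      ((F.filter fun L => x ∈ Metric.ball (p L) (R + D) : Finset C) : Set C)) ?_)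
    · rw [Subtype.val_injective.encard_image, Set.encard_coe_eq_coe_finsetCard] at this
      exact_mod_cast this
    · rintro L ⟨hLC, q, hqL, hq⟩
      refine ⟨⟨L, hLC⟩, ?_, rfl⟩
      rw [Metric.mem_ball] at hx hq
      have hdist : ∀ y ∈ L, dist y q < D := fun y hy =>
        ((hC L hLC).dist_le_diam hK.2.1.isBounded hy hqL).trans_lt hD
      have hLr : L ⊆ Metric.ball 0 r := fun y hy => by
        rw [Metric.mem_ball]
        linarith [dist_triangle4 y q x 0, hdist y hy]
      simp only [Finset.coe_filter, Set.mem_ofPred_eq]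
      refine ⟨?_, ?_⟩
      · simp only [hF, Set.Finite.mem_toFinset, Set.mem_ofPred_eq]
        rw [inter_eq_left.2 hLr, (hC L hLC).volume_eq]
      · rw [Metric.mem_ball, dist_comm]
        linarith [dist_triangle (p ⟨L, hLC⟩) q x, hdist _ (hpL ⟨L, hLC⟩)]

/-- If some covering has fewer than `n` members meeting some ball of radius `R`, then in an
`n`-reduced family every ball of radius `R` contains fewer than `n` members. -/
lemma IsNReduced.encard_lt (hn : 0 < n) (hcov : ⋃₀ C = univ) (hred : IsNReduced K C n)
    {C' : Set (Set (Euc d))} (hC' : IsCovering K C') {x : Euc d}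
    (hx : {L ∈ C' | (L ∩ Metric.ball x R).Nonempty}.encard < n) (y : Euc d) :
    {L ∈ C | L ⊆ Metric.ball y R}.encard < n := by
  by_contra! h
  refine hred ?_
  obtain ⟨S, hS, hSn⟩ := exists_subset_encard_eq h
  set A := {L ∈ C' | (L ∩ Metric.ball x R).Nonempty} with hA
  have hAfin : A.Finite := finite_of_encard_le_coe hx.le
  have hAcard : A.ncard ≤ n - 1 := by
    rw [hAfin.cast_ncard_eq.symm] at hx
    have : A.ncard < n := by exact_mod_cast hx
    omega
  obtain ⟨f, hf⟩ : ∃ f : Fin (n - 1) → Set (Euc d), (∀ j, IsReplica K (f j)) ∧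
      ∀ L ∈ A, ∃ j, f j = L := by
    have := hAfin.to_subtype
    let e := Finite.equivFinOfCardEq (Nat.card_coe_set_eq A)
    refine ⟨fun j => if h : (j : ℕ) < A.ncard then e.symm ⟨j, h⟩ else K, fun j => ?_,
      fun L hL => ⟨⟨e ⟨L, hL⟩, (e ⟨L, hL⟩).2.trans_le hAcard⟩, by simp⟩⟩
    by_cases h : (j : ℕ) < A.ncard
    · simpa [h] using hC'.1 _ (e.symm ⟨j, h⟩).2.1
    · simpa [h] using isReplica_self K
  let g : Euc d ≃ᵢ Euc d := IsometryEquiv.addRight (y - x)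
  refine ⟨S, fun j => g '' f j, hS.trans (sep_subset _ _), finite_of_encard_eq_coe hSn,
    by rw [ncard_def, hSn]; rfl, fun j => (hf.1 j).image g, eq_univ_of_forall fun z => ?_⟩
  by_cases hz : z ∈ Metric.ball y R
  · right
    obtain ⟨L, hL, hzL⟩ : z - (y - x) ∈ ⋃₀ C' := hC'.2 ▸ mem_univ _
    have hzx : z - (y - x) ∈ Metric.ball x R := by
      rw [mem_ball_iff_norm] at hz ⊢
      convert hz using 2
      abel
    obtain ⟨j, rfl⟩ := hf.2 L ⟨hL, _, hzL, hzx⟩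
    exact mem_iUnion.2 ⟨j, _, hzL, by simp [g]⟩
  · left
    obtain ⟨L, hL, hzL⟩ : z ∈ ⋃₀ C := hcov ▸ mem_univ _
    exact ⟨L, ⟨hL, fun hLS => hz ((hS hLS).2 hzL)⟩, hzL⟩

lemma IsNReduced.upperDensity_le (hd : 0 < d) (hK : IsBody K) (hn : 0 < n)
    (hC : IsCovering K C) (hred : IsNReduced K C n) (hD : Metric.diam K < D) (hR : D < R)
    (hlt : coveringDensity K < n * volume K / volume (Metric.ball (0 : Euc d) (R + D))) :
    upperDensity C ≤ n * volume K / volume (Metric.ball (0 : Euc d) (R - D)) := by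
  obtain ⟨C', hC', x, hx⟩ : ∃ C', IsCovering K C' ∧ ∃ x,
      {L ∈ C' | (L ∩ Metric.ball x R).Nonempty}.encard < n := by
    by_contra! h
    refine hlt.not_ge (le_iInf₂ fun C' hC' => ?_)
    exact le_lowerDensity_of_le_encard hd hK hC'.1 hD
      ((Metric.diam_nonneg.trans_lt hD).trans hR) (h C' hC')
  exact upperDensity_le_of_encard_le hd hK.2.1 hK.1 hC.1 hD hR
    fun y => (hred.encard_lt hn hC.2 hC' hx y).le

end Density

/-- Choice of the radius `s` balancing the two volume estimates. -/
lemma exists_radius_pow_bounds {d : ℕ} (hd : 0 < d) {t v ω D : ℝ} (ht : 0 ≤ t) (hv : 0 < v)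
    (hω : 0 < ω) (hD : 0 < D) :
    ∃ C₀ > 0, ∃ A > 0, ∀ a ≥ A, ∃ s, 2 * D < s ∧ t < a ^ d * v / (s ^ d * ω) ∧
      a ^ d * v / ((s - 2 * D) ^ d * ω) ≤ t + C₀ * a⁻¹ := by
  have hd' : (1 : ℝ) ≤ d := by exact_mod_cast hd
  obtain ⟨c, hc, hcd⟩ : ∃ c > 0, c ^ d = v / ((t + 1) * ω) :=
    ⟨(v / ((t + 1) * ω)) ^ (d⁻¹ : ℝ), by positivity,
      Real.rpow_inv_natCast_pow (by positivity) hd.ne'⟩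
  refine ⟨1 + (t + 1) * (4 * d * D / c), by positivity, 1 + 4 * d * D / c, by positivity,
    fun a ha => ?_⟩
  have hq : 0 < 4 * d * D / c := by positivity
  have ha1 : 1 ≤ a := by linarith
  have ha0 : 0 < a := by linarith
  have hε : a⁻¹ ≤ 1 := inv_le_one_of_one_le₀ ha1
  have hε0 : 0 < a⁻¹ := by positivity
  obtain ⟨s, hs, hsd⟩ : ∃ s > 0, s ^ d = a ^ d * v / ((t + a⁻¹) * ω) :=
    ⟨(a ^ d * v / ((t + a⁻¹) * ω)) ^ (d⁻¹ : ℝ), by positivity,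
      Real.rpow_inv_natCast_pow (by positivity) hd.ne'⟩
  have hs_eq : a ^ d * v / (s ^ d * ω) = t + a⁻¹ := by
    rw [hsd]
    have : t + a⁻¹ ≠ 0 := by positivity
    field_simp
  have hacs : a * c ≤ s := by
    refine le_of_pow_le_pow_left₀ hd.ne' hs.le ?_
    rw [mul_pow, hcd, hsd, mul_div_assoc]
    gcongr
  set u := 2 * D / s with hu
  have hu0 : 0 < u := by positivity
  have hdu : 2 * (d * u) ≤ 4 * d * D / c * a⁻¹ := by
    calc 2 * (d * u) ≤ 2 * (d * (2 * D / (a * c))) := by rw [hu]; gcongr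
      _ = _ := by field_simp; ring
  have hdu1 : 2 * (d * u) ≤ 1 := by
    refine hdu.trans ?_
    rw [← div_eq_mul_inv, div_le_one ha0]
    linarith
  have hu1 : u ≤ 1 / 2 := by nlinarith
  have hsu : s - 2 * D = s * (1 - u) := by rw [hu]; field_simp
  refine ⟨s, by nlinarith, by linarith, ?_⟩
  have hbern : 1 - d * u ≤ (1 - u) ^ d := by
    have := one_add_mul_le_pow (a := -u) (by linarith) d
    simpa [sub_eq_add_neg] using this
  have hinv : ((1 - u) ^ d)⁻¹ ≤ 1 + 2 * (d * u) := by
    rw [inv_le_iff_one_le_mul₀ (by apply pow_pos; linarith)]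
    have : 0 ≤ d * u := by positivity
    nlinarith
  calc a ^ d * v / ((s - 2 * D) ^ d * ω)
      = a ^ d * v / (s ^ d * ω) * ((1 - u) ^ d)⁻¹ := by
        rw [hsu, mul_pow]
        have : (1 - u) ^ d ≠ 0 := by apply pow_ne_zero; linarith
        field_simp
    _ ≤ (t + a⁻¹) * (1 + 2 * (d * u)) := by rw [hs_eq]; gcongr
    _ ≤ (t + a⁻¹) * (1 + 4 * d * D / c * a⁻¹) := by gcongr
    _ ≤ t + (1 + (t + 1) * (4 * d * D / c)) * a⁻¹ := by
      have : 0 ≤ (1 - a⁻¹) * (4 * d * D / c * a⁻¹) :=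
        mul_nonneg (by linarith) (by positivity)
      nlinarith

lemma natCast_mul_volume_div_volume_ball {d : ℕ} (hd : 0 < d) {K : Set (Euc d)}
    (hK : volume K ≠ ⊤) (n : ℕ) {r : ℝ} (hr : 0 < r) :
    n * volume K / volume (Metric.ball (0 : Euc d) r) =
      ENNReal.ofReal (n * (volume K).toReal /
        (r ^ d * (volume (Metric.ball (0 : Euc d) 1)).toReal)) := by
  have hω : 0 < (volume (Metric.ball (0 : Euc d) 1)).toReal :=
    ENNReal.toReal_pos (Metric.measure_ball_pos volume _ one_pos).ne' measure_ball_lt_top.ne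
  rw [volume_ball_eq hd hr.le, ENNReal.ofReal_div_of_pos (by positivity),
    ENNReal.ofReal_mul (by positivity), ENNReal.ofReal_mul (by positivity),
    ENNReal.ofReal_toReal hK, ENNReal.ofReal_toReal measure_ball_lt_top.ne,
    ENNReal.ofReal_natCast]

/-- For a body `K` in `Euc d`, there are a constant `C₀ > 0` and a threshold `n₀` such
that for every `n ≥ n₀`, every `n`-reduced covering of `Euc d` with replicas of `K` has
upper density at most `ϑ(K) + C₀·n^(−1/d)`; i.e. `Θ_n(K) ≤ ϑ(K) + O(n^(−1/d))`. -/
theorem n_reduced_covering_density_bound (d : ℕ) (hd : 0 < d) (K : Set (Euc d))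
    (hK : IsBody K) :
    ∃ C₀ : ℝ, 0 < C₀ ∧ ∃ n₀ : ℕ, 0 < n₀ ∧ ∀ n : ℕ, n₀ ≤ n →
      ∀ C : Set (Set (Euc d)), IsCovering K C → IsNReduced K C n →
        upperDensity C ≤
          coveringDensity K + ENNReal.ofReal (C₀ * (n : ℝ) ^ (-(1 : ℝ) / d)) := by
  by_cases htop : coveringDensity K = ⊤
  · exact ⟨1, one_pos, 1, one_pos, fun n _ C _ _ => by simp [htop]⟩
  have hKt : volume K ≠ ⊤ := hK.2.1.measure_lt_top.ne
  have hD : Metric.diam K < Metric.diam K + 1 := lt_add_one _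
  set D := Metric.diam K + 1
  have hD0 : 0 < D := Metric.diam_nonneg.trans_lt hD
  have hω : 0 < (volume (Metric.ball (0 : Euc d) 1)).toReal :=
    ENNReal.toReal_pos (Metric.measure_ball_pos volume _ one_pos).ne' measure_ball_lt_top.ne
  obtain ⟨C₀, hC₀, A, hA, H⟩ := exists_radius_pow_bounds hd
    (ENNReal.toReal_nonneg (a := coveringDensity K))
    (ENNReal.toReal_pos hK.volume_pos.ne' hKt) hω hD0
  refine ⟨C₀, hC₀, ⌈A ^ d⌉₊, Nat.ceil_pos.2 (by positivity), fun n hn C hC hred => ?_⟩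
  have hAn : A ^ d ≤ n := Nat.ceil_le.1 hn
  have hn0 : 0 < n := (Nat.ceil_pos.2 (by positivity)).trans_le hn
  have had : ((n : ℝ) ^ (d⁻¹ : ℝ)) ^ d = n := Real.rpow_inv_natCast_pow n.cast_nonneg hd.ne'
  have hinv : (n : ℝ) ^ (-(1 : ℝ) / d) = ((n : ℝ) ^ (d⁻¹ : ℝ))⁻¹ := by
    rw [← Real.rpow_neg n.cast_nonneg, neg_div, one_div]
  obtain ⟨s, hs, hlow, hupp⟩ := H ((n : ℝ) ^ (d⁻¹ : ℝ))
    (le_of_pow_le_pow_left₀ hd.ne' (by positivity) (hAn.trans_eq had.symm))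
  rw [had] at hlow hupp
  have hmain := hred.upperDensity_le hd hK hn0 hC hD (R := s - D) (by linarith) (by
    rw [sub_add_cancel, natCast_mul_volume_div_volume_ball hd hKt n (by linarith)]
    exact (ENNReal.lt_ofReal_iff_toReal_lt htop).2 hlow)
  refine hmain.trans ?_
  rw [natCast_mul_volume_div_volume_ball hd hKt n (by linarith), hinv,
    ← ENNReal.ofReal_toReal htop, ← ENNReal.ofReal_add ENNReal.toReal_nonneg (by positivity)]
  refine ENNReal.ofReal_le_ofReal ?_
  rwa [sub_sub, ← two_mul]
end
end

section
/- For every d ≥ 2 and every D > 0 there exists a covering of E^d with closed unit balls which is 2-reduced and whose lower density exceeds D. Consequently Θ_2(B^d) = ∞ (and hence also Θ_1(B^d) = ∞). -/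
open Set MeasureTheory

noncomputable section

/-- A covering of `Euc d` with closed unit balls. -/
def IsUnitBallCovering {d : ℕ} (C : Set (Set (Euc d))) : Prop :=
  (∀ L ∈ C, ∃ x : Euc d, L = Metric.closedBall x 1) ∧ ⋃₀ C = univ

/-- A covering with unit balls is `n`-reduced if one cannot delete `n` members and
replace them by `n - 1` closed unit balls so that the result is still a covering. -/
def IsNReducedBalls {d : ℕ} (C : Set (Set (Euc d))) (n : ℕ) : Prop :=
  ¬ ∃ (S : Set (Set (Euc d))) (c : Fin (n - 1) → Euc d),
      S ⊆ C ∧ S.Finite ∧ S.ncard = n ∧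
      (⋃₀ (C \ S)) ∪ (⋃ j, Metric.closedBall (c j) 1) = univ

open Filter Topology

/-- The point with integer coordinates `z` of the lattice whose layers orthogonal to the `i₀`-axis
are cubic lattices of spacing `2 * e`, consecutive layers having distance `h` and being shifted so
that the points of one lie over the deep holes of the other. -/
def layeredPoint {d : ℕ} (i₀ : Fin d) (e h : ℝ) (z : Fin d → ℤ) : Euc d :=
  WithLp.toLp 2 fun i => if i = i₀ then h * z i₀ else e * (2 * z i + z i₀)

lemma dist_layeredPoint_sq {d : ℕ} (i₀ : Fin d) (e h : ℝ) (z : Fin d → ℤ) (p : Euc d) :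
    dist p (layeredPoint i₀ e h z) ^ 2 = (p i₀ - h * z i₀) ^ 2 +
      ∑ i ∈ Finset.univ.erase i₀, (p i - e * (2 * z i + z i₀)) ^ 2 := by
  rw [EuclideanSpace.dist_eq, Real.sq_sqrt (Finset.sum_nonneg fun _ _ => sq_nonneg _),
    ← Finset.add_sum_erase _ _ (Finset.mem_univ i₀)]
  congr 1
  · simp [layeredPoint, Real.dist_eq, sq_abs]
  · refine Finset.sum_congr rfl fun i hi => ?_
    simp [layeredPoint, Real.dist_eq, sq_abs, Finset.ne_of_mem_erase hi]

lemma dist_le_one_iff_sq {X : Type*} [PseudoMetricSpace X] (x y : X) :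
    dist x y ≤ 1 ↔ dist x y ^ 2 ≤ 1 :=
  (sq_le_one_iff₀ dist_nonneg).symm

/-- A real number lies between two consecutive multiples of `e`, one of which has the parity
of `k`. -/
lemma exists_sq_sub_add_sq_sub_le {e : ℝ} (he : 0 < e) (t : ℝ) (k : ℤ) :
    ∃ z z' : ℤ, (t - e * (2 * z + k)) ^ 2 + (t - e * (2 * z' + (k + 1))) ^ 2 ≤ e ^ 2 := by
  have h₁ : (⌊t / e⌋ : ℝ) * e ≤ t := (le_div_iff₀ he).1 (Int.floor_le _)
  have h₂ : t ≤ (⌊t / e⌋ + 1 : ℝ) * e := ((div_lt_iff₀ he).1 (Int.lt_floor_add_one _)).le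
  obtain ⟨w, hw | hw⟩ := Int.even_or_odd' (⌊t / e⌋ - k)
  · have hw' : (⌊t / e⌋ : ℝ) = 2 * w + k := by exact_mod_cast (by omega : ⌊t / e⌋ = 2 * w + k)
    rw [hw'] at h₁ h₂
    exact ⟨w, w, by nlinarith⟩
  · have hw' : (⌊t / e⌋ : ℝ) = 2 * w + 1 + k := by
      exact_mod_cast (by omega : ⌊t / e⌋ = 2 * w + 1 + k)
    rw [hw'] at h₁ h₂
    refine ⟨w + 1, w, ?_⟩
    push_cast
    nlinarith

/-- A point between two parallel hyperplanes at distance `1 + s` is in the unit ball around a point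
of one of them if its orthogonal offsets have squares `A`, `B` with `A + B ≤ 1 - s ^ 2`. -/
lemma sq_le_or_sq_le {a b s A B : ℝ} (ha : 0 ≤ a) (hb : 0 ≤ b)
    (hab : a + b = 1 + s) (hA : 0 ≤ A) (hB : 0 ≤ B) (hAB : A + B ≤ 1 - s ^ 2) :
    a ^ 2 + A ≤ 1 ∨ b ^ 2 + B ≤ 1 := by
  by_contra! h
  have hA₁ : A ≤ 1 := by nlinarith
  have hB₁ : B ≤ 1 := by nlinarith
  have h₁ : s ^ 2 < (a * b) ^ 2 := by
    have : (1 - A) * (1 - B) < a ^ 2 * b ^ 2 :=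
      mul_lt_mul'' (by linarith) (by linarith) (by linarith) (by linarith)
    nlinarith [mul_nonneg hA hB]
  have h₂ : s < a * b := lt_of_pow_lt_pow_left₀ 2 (mul_nonneg ha hb) h₁
  nlinarith [congrArg (· ^ 2) hab]

lemma exists_dist_layeredPoint_le_one {d : ℕ} (i₀ : Fin d) {e s : ℝ} (he : 0 < e) (hs : 0 < s)
    (hes : (d - 1) * e ^ 2 = 1 - s ^ 2) (p : Euc d) :
    ∃ z, dist p (layeredPoint i₀ e (1 + s) z) ≤ 1 := by
  have hh : 0 < 1 + s := by linarith
  set k := ⌊p i₀ / (1 + s)⌋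
  have h₁ : (k : ℝ) * (1 + s) ≤ p i₀ := (le_div_iff₀ hh).1 (Int.floor_le _)
  have h₂ : p i₀ ≤ (k + 1 : ℝ) * (1 + s) := ((div_lt_iff₀ hh).1 (Int.lt_floor_add_one _)).le
  choose z z' hz using fun i => exists_sq_sub_add_sq_sub_le he (p i) k
  have hsum : ∑ i ∈ Finset.univ.erase i₀, (p i - e * (2 * z i + k)) ^ 2 +
      ∑ i ∈ Finset.univ.erase i₀, (p i - e * (2 * z' i + (k + 1))) ^ 2 ≤ 1 - s ^ 2 := by
    rw [← Finset.sum_add_distrib, ← hes]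
    refine (Finset.sum_le_card_nsmul _ _ (e ^ 2) fun i _ => hz i).trans_eq ?_
    have : 1 ≤ d := i₀.pos
    simp [Finset.card_erase_of_mem, Nat.cast_sub this]
  have hupd (w : Fin d → ℤ) (m : ℤ) :
      dist p (layeredPoint i₀ e (1 + s) (Function.update w i₀ m)) ≤ 1 ↔
      (p i₀ - (1 + s) * m) ^ 2 +
        ∑ i ∈ Finset.univ.erase i₀, (p i - e * (2 * w i + m)) ^ 2 ≤ 1 := by
    rw [dist_le_one_iff_sq, dist_layeredPoint_sq, Function.update_self]
    have (i) (hi : i ∈ Finset.univ.erase i₀) : Function.update w i₀ m i = w i :=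
      Function.update_of_ne (Finset.ne_of_mem_erase hi) _ _
    rw [Finset.sum_congr rfl fun i hi => by rw [this i hi]]
  obtain h | h := sq_le_or_sq_le (a := p i₀ - (1 + s) * k) (b := (1 + s) * (k + 1) - p i₀)
    (by linarith) (by linarith) (by ring) (Finset.sum_nonneg fun _ _ => sq_nonneg _)
    (Finset.sum_nonneg fun _ _ => sq_nonneg _) hsum
  · exact ⟨_, (hupd z k).2 h⟩
  · refine ⟨_, (hupd z' (k + 1)).2 ?_⟩
    push_cast
    rwa [sub_sq_comm]

/-- The points on the `i₀`-diameter of a ball of the layered covering that are close to its ends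
belong to no other ball of the covering. -/
lemma eq_of_dist_layeredPoint_add_single_le_one {d : ℕ} (i₀ : Fin d) {e s t : ℝ} (he : 0 < e)
    (hs : 0 < s) (hes : (d - 1) * e ^ 2 = 1 - s ^ 2) (ht : |t| < 1) (ht' : 1 - 4 * e ^ 2 < t ^ 2)
    (z z' : Fin d → ℤ)
    (h : dist (layeredPoint i₀ e (1 + s) z + EuclideanSpace.single i₀ t)
      (layeredPoint i₀ e (1 + s) z') ≤ 1) : z' = z := by
  rw [dist_le_one_iff_sq, dist_layeredPoint_sq] at h
  have hsum : ∑ i ∈ Finset.univ.erase i₀,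
      ((layeredPoint i₀ e (1 + s) z + EuclideanSpace.single i₀ t) i -
        e * (2 * z' i + z' i₀)) ^ 2 =
      ∑ i ∈ Finset.univ.erase i₀, e ^ 2 * ((2 * (z' i - z i) + (z' i₀ - z i₀) : ℤ) : ℝ) ^ 2 := by
    refine Finset.sum_congr rfl fun i hi => ?_
    have := Finset.ne_of_mem_erase hi
    simp only [layeredPoint, PiLp.add_apply, this, if_false, PiLp.single_apply]
    push_cast
    ring
  have hzero : (layeredPoint i₀ e (1 + s) z + EuclideanSpace.single i₀ t) i₀ -
      (1 + s) * z' i₀ = t - (1 + s) * (z' i₀ - z i₀ : ℤ) := by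
    simp only [layeredPoint, PiLp.add_apply, if_true, PiLp.single_apply]
    push_cast
    ring
  rw [hsum, hzero] at h
  obtain ⟨ht₁, ht₂⟩ := abs_lt.1 ht
  have hnonneg : 0 ≤ ∑ i ∈ Finset.univ.erase i₀,
      e ^ 2 * ((2 * (z' i - z i) + (z' i₀ - z i₀) : ℤ) : ℝ) ^ 2 :=
    Finset.sum_nonneg fun _ _ => by positivity
  have hodd (hw : Odd (z' i₀ - z i₀)) : 1 - s ^ 2 ≤ ∑ i ∈ Finset.univ.erase i₀,
      e ^ 2 * ((2 * (z' i - z i) + (z' i₀ - z i₀) : ℤ) : ℝ) ^ 2 := by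
    have hcard : (1 - s ^ 2) = (Finset.univ.erase i₀).card • e ^ 2 := by
      have : 1 ≤ d := i₀.pos
      simp [Finset.card_erase_of_mem, Nat.cast_sub this, hes]
    rw [hcard]
    refine Finset.card_nsmul_le_sum _ _ _ fun i _ => le_mul_of_one_le_right (sq_nonneg e) ?_
    have hne : 2 * (z' i - z i) + (z' i₀ - z i₀) ≠ 0 := by
      obtain ⟨m, hm⟩ := hw
      omega
    exact_mod_cast Int.add_one_le_iff.2 (sq_pos_of_ne_zero hne)
  have hcases : z' i₀ - z i₀ = 0 ∨ z' i₀ - z i₀ = 1 ∨ z' i₀ - z i₀ = -1 ∨ 2 ≤ z' i₀ - z i₀ ∨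
    z' i₀ - z i₀ ≤ -2 := by omega
  obtain hw | hw | hw | hw | hw := hcases
  · by_contra hne
    obtain ⟨i, hi⟩ := Function.ne_iff.1 hne
    have hi₀ : i ≠ i₀ := by
      rintro rfl
      omega
    have hle := Finset.single_le_sum (f := fun i =>
      e ^ 2 * ((2 * (z' i - z i) + (z' i₀ - z i₀) : ℤ) : ℝ) ^ 2) (fun _ _ => by positivity)
      (Finset.mem_erase.2 ⟨hi₀, Finset.mem_univ i⟩)
    have hone : (1 : ℝ) ≤ ((z' i - z i : ℤ) : ℝ) ^ 2 := by
      exact_mod_cast Int.add_one_le_iff.2 (sq_pos_of_ne_zero (sub_ne_zero.2 hi))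
    rw [hw] at h hle
    push_cast at h hle hone
    nlinarith [mul_le_mul_of_nonneg_left hone (sq_nonneg e)]
  · have := hodd (by rw [hw]; decide)
    rw [hw] at h this
    push_cast at h this
    nlinarith
  · have := hodd (by rw [hw]; decide)
    rw [hw] at h this
    push_cast at h this
    nlinarith
  · have : (2 : ℝ) ≤ (z' i₀ - z i₀ : ℤ) := by exact_mod_cast hw
    have : t - (1 + s) * (z' i₀ - z i₀ : ℤ) < -1 := by nlinarith
    nlinarith
  · have : ((z' i₀ - z i₀ : ℤ) : ℝ) ≤ -2 := by exact_mod_cast hw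
    have : 1 < t - (1 + s) * (z' i₀ - z i₀ : ℤ) := by nlinarith
    nlinarith

/-- A unit ball containing the points near both ends of a diameter of another unit ball has the
same center. -/
lemma eq_of_forall_dist_add_single_le_one {d : ℕ} (i₀ : Fin d) {a : ℝ} (ha : a < 1) {x y : Euc d}
    (h : ∀ t : ℝ, |t| < 1 → a < t ^ 2 → dist (x + EuclideanSpace.single i₀ t) y ≤ 1) : x = y := by
  have hlt (t : ℝ) (ht₀ : 0 < t) (ht : t < 1) (hat : a < t ^ 2) :
      ‖x - y‖ ^ 2 ≤ 1 - t ^ 2 := by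
    have h₁ := h t (by rwa [abs_of_pos ht₀]) hat
    have h₂ := h (-t) (by rwa [abs_neg, abs_of_pos ht₀]) (by rwa [neg_sq])
    have hs : EuclideanSpace.single i₀ (-t) = -EuclideanSpace.single i₀ t := by
      ext i
      by_cases hi : i = i₀ <;> simp [hi]
    rw [dist_eq_norm, add_sub_right_comm] at h₁ h₂
    rw [hs, ← sub_eq_add_neg] at h₂
    have hp := parallelogram_law_with_norm ℝ (x - y) (EuclideanSpace.single i₀ t)
    rw [PiLp.norm_single, Real.norm_eq_abs, sq_abs] at hp
    nlinarith [norm_nonneg (x - y + EuclideanSpace.single i₀ t),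
      norm_nonneg (x - y - EuclideanSpace.single i₀ t)]
  have hlim : Tendsto (fun t : ℝ => 1 - t ^ 2) (𝓝[<] 1) (𝓝 0) := by
    have : Tendsto (fun t : ℝ => 1 - t ^ 2) (𝓝 1) (𝓝 (1 - 1 ^ 2)) :=
      Continuous.tendsto (by fun_prop) 1
    simpa using this.mono_left nhdsWithin_le_nhds
  have hev : ∀ᶠ t : ℝ in 𝓝[<] 1, ‖x - y‖ ^ 2 ≤ 1 - t ^ 2 := by
    have h₁ : ∀ᶠ t : ℝ in 𝓝 1, a < t ^ 2 :=
      (Continuous.tendsto (by fun_prop : Continuous fun t : ℝ => t ^ 2) 1).eventually_const_lt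
        (by simpa using ha)
    filter_upwards [self_mem_nhdsWithin, nhdsWithin_le_nhds h₁,
      nhdsWithin_le_nhds (lt_mem_nhds zero_lt_one)] with t ht hat ht₀
    exact hlt t ht₀ ht hat
  have := ge_of_tendsto hlim hev
  rw [← sub_eq_zero, ← norm_eq_zero]
  exact pow_eq_zero_iff two_ne_zero |>.1 (le_antisymm this (sq_nonneg _))

lemma exists_abs_lt_one_lt_sq {a : ℝ} (ha : a < 1) : ∃ t : ℝ, |t| < 1 ∧ a < t ^ 2 := by
  obtain ⟨b, hb, hb₁⟩ := exists_between (max_lt ha zero_lt_one)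
  obtain ⟨hab, hb₀⟩ := max_lt_iff.1 hb
  refine ⟨√b, ?_, by rwa [Real.sq_sqrt hb₀.le]⟩
  rwa [abs_of_nonneg (Real.sqrt_nonneg b), Real.sqrt_lt' one_pos, one_pow]

lemma closedBall_layeredPoint_injective {d : ℕ} (i₀ : Fin d) {e s : ℝ} (he : 0 < e)
    (hs : 0 < s) (hes : (d - 1) * e ^ 2 = 1 - s ^ 2) :
    Function.Injective fun z => Metric.closedBall (layeredPoint i₀ e (1 + s) z) 1 := by
  intro z z' h
  obtain ⟨t, ht, ht'⟩ := exists_abs_lt_one_lt_sq (a := 1 - 4 * e ^ 2) (by nlinarith)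
  refine (eq_of_dist_layeredPoint_add_single_le_one i₀ he hs hes ht ht' z z' ?_).symm
  have : layeredPoint i₀ e (1 + s) z + EuclideanSpace.single i₀ t ∈
      Metric.closedBall (layeredPoint i₀ e (1 + s) z) 1 := by
    simpa [dist_eq_norm] using ht.le
  exact h.subset this

lemma isNReducedBalls_range_layeredPoint {d : ℕ} (i₀ : Fin d) {e s : ℝ} (he : 0 < e)
    (hs : 0 < s) (hes : (d - 1) * e ^ 2 = 1 - s ^ 2) :
    IsNReducedBalls (range fun z => Metric.closedBall (layeredPoint i₀ e (1 + s) z) 1) 2 := by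
  rintro ⟨S, c, hSC, -, hcard, hcov⟩
  have hS (A) (hA : A ∈ S) : A = Metric.closedBall (c 0) 1 := by
    obtain ⟨z, rfl⟩ := hSC hA
    have := eq_of_forall_dist_add_single_le_one i₀ (a := 1 - 4 * e ^ 2) (by nlinarith)
      (x := layeredPoint i₀ e (1 + s) z) (y := c 0) fun t ht ht' => ?_
    · simp only [this]
    have hmem := hcov.ge (mem_univ (layeredPoint i₀ e (1 + s) z + EuclideanSpace.single i₀ t))
    obtain ⟨L, ⟨⟨z', rfl⟩, hL⟩, hmem⟩ | hmem := hmem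
    · rw [eq_of_dist_layeredPoint_add_single_le_one i₀ he hs hes ht ht' z z' hmem] at hL
      exact absurd hA hL
    · obtain ⟨j, hj⟩ := mem_iUnion.1 hmem
      rwa [show j = 0 from Fin.fin_one_eq_zero j] at hj
  obtain ⟨A, B, hAB, rfl⟩ := ncard_eq_two.1 hcard
  exact hAB ((hS A (by simp)).trans (hS B (by simp)).symm)

/-- If the translates of `K` by the points `b u` cover the space, then the unit balls around these
points have density at least `volume (closedBall 0 1) / volume K`. -/
lemma volume_mul_volume_le_tsum_mul {d : ℕ} {ι : Type*} [Countable ι] (b : ι → Euc d)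
    {K : Set (Euc d)} {R : ℝ} (hK : ∀ x ∈ K, ‖x‖ ≤ R) (hcov : ∀ p, ∃ u, p - b u ∈ K) (r : ℝ) :
    volume (Metric.closedBall (0 : Euc d) 1) * volume (Metric.ball (0 : Euc d) (r - (R + 1))) ≤
      (∑' u, volume (Metric.closedBall (b u) 1 ∩ Metric.ball 0 r)) * volume K := by
  have hsub : Metric.ball (0 : Euc d) (r - (R + 1)) ⊆
      ⋃ u, {p | ‖b u‖ < r - 1 ∧ p - b u ∈ K} := by
    intro p hp
    obtain ⟨u, hu⟩ := hcov p
    have h₁ := norm_le_norm_add_norm_sub' (b u) p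
    have h₂ := hK _ hu
    rw [norm_sub_rev] at h₂
    rw [mem_ball_zero_iff] at hp
    exact mem_iUnion.2 ⟨u, by linarith, hu⟩
  calc _ ≤ volume (Metric.closedBall (0 : Euc d) 1) *
        ∑' u, volume {p | ‖b u‖ < r - 1 ∧ p - b u ∈ K} := by
        gcongr
        exact (measure_mono hsub).trans (measure_iUnion_le _)
    _ = ∑' u, volume (Metric.closedBall (0 : Euc d) 1) *
        volume {p | ‖b u‖ < r - 1 ∧ p - b u ∈ K} := ENNReal.tsum_mul_left.symm
    _ ≤ ∑' u, volume (Metric.closedBall (b u) 1 ∩ Metric.ball 0 r) * volume K := by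
        refine ENNReal.tsum_le_tsum fun u => ?_
        by_cases hu : ‖b u‖ < r - 1
        · have hball : Metric.closedBall (b u) 1 ⊆ Metric.ball 0 r :=
            Metric.closedBall_subset_ball' (by rw [dist_zero_right]; linarith)
          have hpre : {p | ‖b u‖ < r - 1 ∧ p - b u ∈ K} = (fun p => p - b u) ⁻¹' K := by
            ext p
            simp [hu]
          have hvol : volume ((fun p => p - b u) ⁻¹' K) = volume K :=
            (measurePreserving_sub_right volume (b u)).measure_preimage_emb
              (MeasurableEquiv.subRight (b u)).measurableEmbedding K
          rw [inter_eq_left.2 hball, hpre, hvol,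
            Measure.addHaar_closedBall_center volume (b u)]
        · simp [hu]
    _ = _ := ENNReal.tsum_mul_right

lemma ofReal_lt_lowerDensity {d : ℕ} [NeZero d] {ι : Type*} [Countable ι] (b : ι → Euc d)
    (hb : Function.Injective fun u => Metric.closedBall (b u) 1)
    {K : Set (Euc d)} {R : ℝ} (hK : ∀ x ∈ K, ‖x‖ ≤ R) (hcov : ∀ p, ∃ u, p - b u ∈ K)
    {D : ℝ} (hD : 0 < D)
    (hDK : ENNReal.ofReal D * volume K < volume (Metric.closedBall (0 : Euc d) 1)) :
    ENNReal.ofReal D < lowerDensity (range fun u => Metric.closedBall (b u) 1) := by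
  have hKtop : volume K ≠ ⊤ :=
    (isBounded_iff_forall_norm_le.2 ⟨R, hK⟩).measure_lt_top.ne
  have hVtop : volume (Metric.closedBall (0 : Euc d) 1) ≠ ⊤ :=
    Metric.isBounded_closedBall.measure_lt_top.ne
  have hlim : Tendsto (fun r : ℝ => ENNReal.ofReal (((r - (R + 1)) / r) ^ d) *
      volume (Metric.closedBall (0 : Euc d) 1)) atTop
      (𝓝 (volume (Metric.closedBall (0 : Euc d) 1))) := by
    have h₁ : Tendsto (fun r : ℝ => 1 - (R + 1) / r) atTop (𝓝 (1 - 0)) :=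
      tendsto_const_nhds.sub (tendsto_const_nhds.div_atTop tendsto_id)
    have h₂ : Tendsto (fun r : ℝ => (r - (R + 1)) / r) atTop (𝓝 1) := by
      rw [sub_zero] at h₁
      refine h₁.congr' ?_
      filter_upwards [eventually_ne_atTop 0] with r hr
      field_simp
    simpa using ENNReal.Tendsto.mul_const (ENNReal.tendsto_ofReal (h₂.pow d)) (Or.inr hVtop)
  obtain ⟨D', hDD', hD'⟩ : ∃ D', D < D' ∧ ENNReal.ofReal D' * volume K <
      volume (Metric.closedBall (0 : Euc d) 1) := by
    have hcont : Tendsto (fun x : ℝ => ENNReal.ofReal x * volume K) (𝓝[>] D)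
        (𝓝 (ENNReal.ofReal D * volume K)) :=
      (ENNReal.Tendsto.mul_const (ENNReal.tendsto_ofReal tendsto_id)
        (Or.inr hKtop)).mono_left nhdsWithin_le_nhds
    exact (eventually_mem_nhdsWithin.and (hcont.eventually_lt_const hDK)).exists
  refine ((ENNReal.ofReal_lt_ofReal_iff (hD.trans hDD')).2 hDD').trans_le
    (le_liminf_of_le (by isBoundedDefault) ?_)
  filter_upwards [hlim.eventually_const_lt hD', eventually_gt_atTop 0,
    eventually_gt_atTop (R + 1)] with r hr hr₀ hrR
  have htsum : ∑' L : range fun u => Metric.closedBall (b u) 1,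
      volume ((L : Set (Euc d)) ∩ Metric.ball 0 r) =
      ∑' u, volume (Metric.closedBall (b u) 1 ∩ Metric.ball 0 r) :=
    tsum_range (fun L : Set (Euc d) => volume (L ∩ Metric.ball 0 r)) hb
  have hball (ρ : ℝ) (hρ : 0 ≤ ρ) : volume (Metric.ball (0 : Euc d) ρ) =
      ENNReal.ofReal (ρ ^ d) * volume (Metric.ball (0 : Euc d) 1) := by
    simpa using Measure.addHaar_ball (volume : Measure (Euc d)) 0 hρ
  have hratio : volume (Metric.ball (0 : Euc d) (r - (R + 1))) =
      ENNReal.ofReal (((r - (R + 1)) / r) ^ d) * volume (Metric.ball (0 : Euc d) r) := by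
    rw [hball _ (sub_nonneg.2 hrR.le), hball _ hr₀.le, ← mul_assoc,
      ← ENNReal.ofReal_mul (by have := sub_nonneg.2 hrR.le; positivity), ← mul_pow,
      div_mul_cancel₀ _ hr₀.ne']
  have hBr : volume (Metric.ball (0 : Euc d) r) ≠ ⊤ := Metric.isBounded_ball.measure_lt_top.ne
  have hK₀ : volume K ≠ 0 := by
    intro h₀
    have h := volume_mul_volume_le_tsum_mul b hK hcov r
    rw [h₀, mul_zero, nonpos_iff_eq_zero, mul_eq_zero] at h
    exact h.elim (Metric.measure_closedBall_pos _ _ one_pos).ne'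
      (Metric.measure_ball_pos _ _ (sub_pos.2 hrR)).ne'
  rw [htsum, ENNReal.le_div_iff_mul_le (Or.inl (Metric.measure_ball_pos _ _ hr₀).ne')
    (Or.inl hBr), ← ENNReal.mul_le_mul_iff_left hK₀ hKtop]
  calc _ = ENNReal.ofReal D' * volume K * volume (Metric.ball (0 : Euc d) r) := by ring
    _ ≤ ENNReal.ofReal (((r - (R + 1)) / r) ^ d) * volume (Metric.closedBall (0 : Euc d) 1) *
        volume (Metric.ball (0 : Euc d) r) := by gcongr
    _ = volume (Metric.closedBall (0 : Euc d) 1) *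
        volume (Metric.ball (0 : Euc d) (r - (R + 1))) := by
      rw [hratio]
      ring
    _ ≤ _ := volume_mul_volume_le_tsum_mul b hK hcov r

/-- The box with side `h` in direction `i₀` and sides `2 * e` in the other directions. -/
def layeredBox {d : ℕ} (i₀ : Fin d) (e h : ℝ) : Set (Euc d) :=
  {x | ∀ i, x i ∈ Icc (if i = i₀ then 0 else -e) (if i = i₀ then h else e)}

lemma volume_layeredBox {d : ℕ} (i₀ : Fin d) {e h : ℝ} (he : 0 ≤ e) (hh : 0 ≤ h) :
    volume (layeredBox i₀ e h) = ENNReal.ofReal (h * (2 * e) ^ (d - 1)) := by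
  have hpre : layeredBox i₀ e h = (WithLp.ofLp : Euc d → Fin d → ℝ) ⁻¹'
      Icc (fun i => if i = i₀ then 0 else -e) (fun i => if i = i₀ then h else e) := by
    ext x
    simp [layeredBox, Pi.le_def, forall_and]
  rw [hpre, (PiLp.volume_preserving_ofLp (Fin d)).measure_preimage
    measurableSet_Icc.nullMeasurableSet, Real.volume_Icc_pi,
    ← Finset.mul_prod_erase _ _ (Finset.mem_univ i₀), ENNReal.ofReal_mul hh,
    ENNReal.ofReal_pow (by positivity)]
  congr 1
  · simp
  · rw [Finset.prod_congr rfl (g := fun _ => ENNReal.ofReal (2 * e))]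
    · simp [Finset.card_erase_of_mem]
    · intro i hi
      simp [Finset.ne_of_mem_erase hi, two_mul]

lemma exists_sub_layeredPoint_mem_layeredBox {d : ℕ} (i₀ : Fin d) {e h : ℝ} (he : 0 < e)
    (hh : 0 < h) (p : Euc d) : ∃ z, p - layeredPoint i₀ e h z ∈ layeredBox i₀ e h := by
  set k := ⌊p i₀ / h⌋
  refine ⟨fun i => if i = i₀ then k else ⌊(p i / e - k + 1) / 2⌋, fun i => ?_⟩
  by_cases hi : i = i₀
  · subst hi
    have h₁ : (k : ℝ) * h ≤ p i := (le_div_iff₀ hh).1 (Int.floor_le _)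
    have h₂ : p i ≤ (k + 1 : ℝ) * h := ((div_lt_iff₀ hh).1 (Int.lt_floor_add_one _)).le
    simp only [layeredPoint, PiLp.sub_apply, if_true, mem_Icc]
    constructor <;> linarith
  · simp only [layeredPoint, PiLp.sub_apply, if_true, hi, if_false, mem_Icc]
    have h₁ := Int.floor_le ((p i / e - k + 1) / 2)
    have h₂ := (Int.lt_floor_add_one ((p i / e - k + 1) / 2)).le
    have hp : p i = e * (p i / e) := by field_simp
    constructor <;> nlinarith

lemma norm_le_of_mem_layeredBox {d : ℕ} (i₀ : Fin d) {e h : ℝ} (he : 0 ≤ e) (hh : 0 ≤ h)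
    {x : Euc d} (hx : x ∈ layeredBox i₀ e h) : ‖x‖ ≤ √(d * (h + e) ^ 2) := by
  rw [EuclideanSpace.norm_eq]
  refine Real.sqrt_le_sqrt ((Finset.sum_le_card_nsmul _ _ ((h + e) ^ 2) fun i _ => ?_).trans_eq
    (by simp))
  have := hx i
  rw [Real.norm_eq_abs, sq_le_sq, abs_abs, abs_of_nonneg (add_nonneg hh he), abs_le]
  split_ifs at this <;> constructor <;> linarith [this.1, this.2]

/-- For every `d ≥ 2` and every `D > 0` there is a `2`-reduced covering of `Euc d` with
closed unit balls whose lower density exceeds `D`; consequently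
`Θ_2(B^d) = ∞` (and hence also `Θ_1(B^d) = ∞`). -/
theorem exists_dense_two_reduced_ball_covering (d : ℕ) (hd : 2 ≤ d)
    (D : ℝ) (hD : 0 < D) :
    ∃ C : Set (Set (Euc d)), IsUnitBallCovering C ∧ IsNReducedBalls C 2 ∧
      ENNReal.ofReal D < lowerDensity C := by
  have : NeZero d := ⟨by omega⟩
  set V := (volume (Metric.closedBall (0 : Euc d) 1)).toReal with hV
  have hVtop : volume (Metric.closedBall (0 : Euc d) 1) ≠ ⊤ :=
    Metric.isBounded_closedBall.measure_lt_top.ne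
  have hVpos : 0 < V := ENNReal.toReal_pos (Metric.measure_closedBall_pos _ _ one_pos).ne' hVtop
  have hd' : (2 : ℝ) ≤ d := by exact_mod_cast hd
  obtain ⟨e, he, hed, heD⟩ : ∃ e : ℝ, 0 < e ∧ e * d < 1 ∧ e * (4 * D) < V := by
    have hsmall (c : ℝ) (a : ℝ) (ha : 0 < a) : ∀ᶠ e : ℝ in 𝓝[>] 0, e * c < a := by
      refine nhdsWithin_le_nhds ((Continuous.tendsto (by fun_prop : Continuous fun e : ℝ => e * c)
        0).eventually_lt_const ?_)
      simpa using ha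
    obtain ⟨e, he, h₁, h₂⟩ := (eventually_mem_nhdsWithin.and
      ((hsmall d 1 one_pos).and (hsmall (4 * D) V hVpos))).exists
    exact ⟨e, he, h₁, h₂⟩
  have hed₁ : (d - 1) * e ^ 2 < 1 := by nlinarith
  set s := √(1 - (d - 1) * e ^ 2)
  have hs : 0 < s := Real.sqrt_pos.2 (by linarith)
  have hes : (d - 1) * e ^ 2 = 1 - s ^ 2 := by
    rw [Real.sq_sqrt (by linarith)]
    ring
  have hs₁ : s ≤ 1 := by nlinarith [mul_nonneg (by linarith : (0 : ℝ) ≤ d - 1) (sq_nonneg e)]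
  let i₀ : Fin d := 0
  refine ⟨range fun z => Metric.closedBall (layeredPoint i₀ e (1 + s) z) 1, ⟨?_, ?_⟩,
    isNReducedBalls_range_layeredPoint i₀ he hs hes,
    ofReal_lt_lowerDensity _ (closedBall_layeredPoint_injective i₀ he hs hes)
      (fun x hx => norm_le_of_mem_layeredBox i₀ he.le (by linarith) hx)
      (exists_sub_layeredPoint_mem_layeredBox i₀ he (by linarith)) hD ?_⟩
  · rintro L ⟨z, rfl⟩
    exact ⟨_, rfl⟩
  · refine eq_univ_of_forall fun p => ?_
    obtain ⟨z, hz⟩ := exists_dist_layeredPoint_le_one i₀ he hs hes p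
    exact ⟨_, ⟨z, rfl⟩, hz⟩
  · rw [volume_layeredBox i₀ he.le (by linarith), ← ENNReal.ofReal_mul hD.le,
      ENNReal.ofReal_lt_iff_lt_toReal (by positivity) hVtop, ← hV]
    have hpow : (2 * e) ^ (d - 1) ≤ 2 * e :=
      pow_le_of_le_one (by linarith) (by nlinarith) (by omega)
    calc D * ((1 + s) * (2 * e) ^ (d - 1)) ≤ D * (2 * (2 * e)) := by
          gcongr
          linarith
      _ = e * (4 * D) := by ring
      _ < V := heD
end
end
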